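/- arXiv:alg-geom/9703001 — 2 statements merged into one kernel-verified Lean document; each statement's English description precedes it below -/
import Mathlib

section
/- Let k be a positive integer and let u ≠ w in S_∞ satisfy conditions I–II for k. Then the set {a ≤ k : u(a) < w(a)} is nonempty; let a be its unique element with u(a) minimal. Then the set {b > k : w(b) < w(a) ≤ u(b)} is nonempty; let b be its unique element with u(b) maximal. Then w∘(a,b) is covered by w in the k-Bruhat order (in particular ℓ(w∘(a,b)) = ℓ(w) − 1), and the pair (u, w∘(a,b)) again satisfies conditions I–II for k. Consequently, iterating this step produces a saturated chain in the k-Bruhat order from u to w of length ℓ(w) − ℓ(u). -/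
/-- `S_∞`: a permutation of the positive integers lies in `S_∞` iff it
fixes all but finitely many integers. -/
def finSupp (w : Equiv.Perm ℕ+) : Prop := {i : ℕ+ | w i ≠ i}.Finite

/-- The length `ℓ(w) = #{(i,j) : i < j and w(i) > w(j)}`. -/
noncomputable def len (w : Equiv.Perm ℕ+) : ℕ :=
  {p : ℕ+ × ℕ+ | p.1 < p.2 ∧ w p.2 < w p.1}.ncard

/-- Cover relation of the `k`-Bruhat order: `w = u∘(a,b)` with `a ≤ k < b`
and `ℓ(w) = ℓ(u) + 1`. -/
def kBruhatCover (k : ℕ) (u w : Equiv.Perm ℕ+) : Prop :=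
  ∃ a b : ℕ+, (a : ℕ) ≤ k ∧ k < (b : ℕ) ∧ w = u * Equiv.swap a b ∧ len w = len u + 1

/-- The `k`-Bruhat order `≤_k`: reflexive–transitive closure of the cover relation. -/
def kBruhatLE (k : ℕ) : Equiv.Perm ℕ+ → Equiv.Perm ℕ+ → Prop :=
  Relation.ReflTransGen (kBruhatCover k)

/-- Conditions I–II for `k`:
(I) `u(a) ≤ w(a)` for `a ≤ k` and `w(b) ≤ u(b)` for `b > k`;
(II) if `a < b`, `u(a) < u(b)` and `w(a) > w(b)` then `a ≤ k < b`. -/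
def condIandII (k : ℕ) (u w : Equiv.Perm ℕ+) : Prop :=
  (∀ a : ℕ+, (a : ℕ) ≤ k → u a ≤ w a) ∧
  (∀ b : ℕ+, k < (b : ℕ) → w b ≤ u b) ∧
  (∀ a b : ℕ+, a < b → u a < u b → w b < w a → (a : ℕ) ≤ k ∧ k < (b : ℕ))

/-- The set of inversions of `w`. -/
def invSet (w : Equiv.Perm ℕ+) : Set (ℕ+ × ℕ+) :=
  {p | p.1 < p.2 ∧ w p.2 < w p.1}

theorem finSupp.finite_invSet {w : Equiv.Perm ℕ+} (hw : finSupp w) : (invSet w).Finite := by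
  obtain ⟨N, hN⟩ := hw.bddAbove
  have fix : ∀ i, N < i → w i = i := fun i hi => by
    by_contra h
    exact absurd (hN h) (not_le.mpr hi)
  have small : ∀ i, i ≤ N → w i ≤ N := fun i hi => by
    by_contra h
    have h1 := w.injective (fix (w i) (not_le.mp h))
    rw [h1] at h
    exact h hi
  refine ((Set.finite_Iic N).prod (Set.finite_Iic N)).subset ?_
  rintro ⟨i, j⟩ ⟨hij, hji⟩
  simp only at hij hji
  have hj : j ≤ N := by
    by_contra h
    rw [not_le] at h
    rw [fix j h] at hji
    rcases le_or_gt i N with hi | hi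
    · exact absurd (h.trans hji) (not_lt.mpr (small i hi))
    · rw [fix i hi] at hji
      exact absurd hij (not_lt.mpr hji.le)
  exact ⟨hij.le.trans hj, hj⟩

theorem finSupp.mul_swap {w : Equiv.Perm ℕ+} (hw : finSupp w) (a b : ℕ+) :
    finSupp (w * Equiv.swap a b) := by
  refine (hw.union (Set.toFinite {a, b})).subset fun i hi => ?_
  by_cases ha : i = a
  · simp [ha]
  by_cases hb : i = b
  · simp [hb]
  left
  simpa [Equiv.swap_apply_of_ne_of_ne ha hb] using hi

/-- Move a pair of positions along `swap a b`, unless that would reverse their order. -/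
def swapPair (a b : ℕ+) (p : ℕ+ × ℕ+) : ℕ+ × ℕ+ :=
  if Equiv.swap a b p.1 < Equiv.swap a b p.2 then (Equiv.swap a b p.1, Equiv.swap a b p.2) else p

theorem swapPair_swapPair (a b : ℕ+) {p : ℕ+ × ℕ+} (hp : p.1 < p.2) :
    swapPair a b (swapPair a b p) = p := by
  unfold swapPair
  by_cases h : Equiv.swap a b p.1 < Equiv.swap a b p.2
  · simp [h, hp]
  · simp [h]

/-- Exchanging two entries that form an inversion with no intermediate value in between
lowers the length by exactly one. -/
theorem len_eq_len_mul_swap_add_one {w : Equiv.Perm ℕ+} (hw : finSupp w) {a b : ℕ+}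
    (hab : a < b) (hwab : w b < w a)
    (hc : ∀ c, a < c → c < b → w b < w c → ¬ w c < w a) :
    len w = len (w * Equiv.swap a b) + 1 := by
  have key : ∀ i j, i < j → ¬ Equiv.swap a b i < Equiv.swap a b j → (i, j) ≠ (a, b) →
      (w j < w i ↔ w (Equiv.swap a b j) < w (Equiv.swap a b i)) := by
    intro i j hij h hne
    have hnec : ∀ x y, x ≠ y → w x ≠ w y := fun x y h h' => h (w.injective h')
    by_cases hia : i = a
    · subst hia
      have hjb : j ≠ b := fun h => hne (by rw [h])
      rw [Equiv.swap_apply_left, Equiv.swap_apply_of_ne_of_ne hij.ne' hjb] at *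
      have := hc j hij (lt_of_le_of_ne (not_lt.mp h) hjb)
      have hjb' := hnec j b hjb
      exact ⟨fun h' => lt_of_le_of_ne (not_lt.mp fun h2 => this h2 h') hjb',
        fun h' => h'.trans hwab⟩
    · by_cases hjb : j = b
      · subst hjb
        rw [Equiv.swap_apply_right, Equiv.swap_apply_of_ne_of_ne hia hij.ne] at *
        have := hc i (lt_of_le_of_ne (not_lt.mp h) (Ne.symm hia)) hij
        have hai' := (hnec i a hia).symm
        exact ⟨fun h' => lt_of_le_of_ne (not_lt.mp fun h2 => this h' h2) hai',
          fun h' => hwab.trans h'⟩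
      · exfalso
        apply h
        by_cases hib : i = b
        · subst hib
          rw [Equiv.swap_apply_right,
            Equiv.swap_apply_of_ne_of_ne (hab.trans hij).ne' hij.ne']
          exact hab.trans hij
        · by_cases hja : j = a
          · subst hja
            rw [Equiv.swap_apply_left, Equiv.swap_apply_of_ne_of_ne hia hib]
            exact hij.trans hab
          · rwa [Equiv.swap_apply_of_ne_of_ne hia hib, Equiv.swap_apply_of_ne_of_ne hja hjb]
  have hself : swapPair a b (a, b) = (a, b) := by
    simp [swapPair, not_lt.mpr hab.le]
  have hset : invSet w = insert (a, b) (swapPair a b '' invSet (w * Equiv.swap a b)) := by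
    ext ⟨i, j⟩
    constructor
    · rintro ⟨hij, hji⟩
      by_cases hp : (i, j) = (a, b)
      · exact Or.inl hp
      refine Or.inr ⟨swapPair a b (i, j), ?_, swapPair_swapPair a b hij⟩
      by_cases h : Equiv.swap a b i < Equiv.swap a b j
      · simpa [swapPair, h, invSet] using hji
      · have := (key i j hij h hp).1 hji
        simpa [swapPair, h, invSet] using ⟨hij, this⟩
    · rintro (hp | ⟨⟨x, y⟩, ⟨hxy, hyx⟩, hp⟩)
      · rw [hp]
        exact ⟨hab, hwab⟩
      · rw [← hp]
        simp only [Equiv.Perm.mul_apply] at hxy hyx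
        by_cases h : Equiv.swap a b x < Equiv.swap a b y
        · simpa [swapPair, h, invSet] using hyx
        · have hne : (x, y) ≠ (a, b) := by
            intro h'
            obtain ⟨rfl, rfl⟩ := Prod.mk.inj h'
            simp only [Equiv.swap_apply_left, Equiv.swap_apply_right] at hyx
            exact absurd hyx (not_lt.mpr hwab.le)
          have := (key x y hxy h hne).2 hyx
          simpa [swapPair, h, invSet] using ⟨hxy, this⟩
  have hnot : (a, b) ∉ swapPair a b '' invSet (w * Equiv.swap a b) := by
    rintro ⟨p, hp, hpe⟩
    have h1 := swapPair_swapPair a b hp.1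
    rw [hpe, hself] at h1
    rw [← h1] at hp
    have := hp.2
    simp only [Equiv.Perm.mul_apply, Equiv.swap_apply_left, Equiv.swap_apply_right] at this
    exact absurd this (not_lt.mpr hwab.le)
  have hinj : Set.InjOn (swapPair a b) (invSet (w * Equiv.swap a b)) := by
    intro p hp q hq hpq
    rw [← swapPair_swapPair a b hp.1, hpq, swapPair_swapPair a b hq.1]
  change (invSet w).ncard = (invSet (w * Equiv.swap a b)).ncard + 1
  rw [hset, Set.ncard_insert_of_notMem hnot ((hw.mul_swap a b).finite_invSet.image _),
    hinj.ncard_image]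

/-- If `w ≤ u` at every position with small `u`-value, then `w` and `u` agree there. -/
theorem eq_of_forall_le_of_lt {u w : Equiv.Perm ℕ+} (m : ℕ+)
    (h : ∀ i, u i < m → w i ≤ u i) : ∀ i, u i < m → w i = u i := by
  suffices H : ∀ x i, u i = x → x < m → w i = x from fun i hi => H _ i rfl hi
  intro x
  induction x using WellFoundedLT.induction with
  | ind x ih =>
    intro i hi hx
    subst hi
    refine (h i hx).eq_of_not_lt fun hlt => ?_
    have h1 := ih (w i) hlt (u.symm (w i)) (u.apply_symm_apply _) (hlt.trans hx)
    have h2 := w.injective h1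
    have h3 : w i = u i := by
      conv_rhs => rw [← h2]
      simp
    exact hlt.ne h3

theorem exists_lt_of_condIandII {k : ℕ} {u w : Equiv.Perm ℕ+} (hne : u ≠ w)
    (hcond : condIandII k u w) : ∃ a : ℕ+, (a : ℕ) ≤ k ∧ u a < w a := by
  by_contra! h
  refine hne (Equiv.ext fun i => ?_)
  refine (eq_of_forall_le_of_lt (u i + 1) (fun j _ => ?_) i (PNat.lt_add_right _ _)).symm
  rcases le_or_gt (j : ℕ) k with hj | hj
  · exact h j hj
  · exact hcond.2.1 j hj

theorem exists_lt_le_of_condIandII {k : ℕ} {u w : Equiv.Perm ℕ+} (hcond : condIandII k u w)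
    {a : ℕ+} (ha : u a < w a) : ∃ b : ℕ+, k < (b : ℕ) ∧ w b < w a ∧ w a ≤ u b := by
  by_contra! h
  have hsub : (Finset.Iio (w a)).image w.symm ⊆ (Finset.Iio (w a)).image u.symm := by
    intro i hi
    simp only [Finset.mem_image, Finset.mem_Iio, Equiv.symm_apply_eq] at hi ⊢
    obtain ⟨x, hx, rfl⟩ := hi
    rcases le_or_gt (i : ℕ) k with hk | hk
    · exact ⟨_, (hcond.1 i hk).trans_lt hx, rfl⟩
    · exact ⟨_, h i hk hx, rfl⟩
  have heq := Finset.eq_of_subset_of_card_le hsub (by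
    rw [Finset.card_image_of_injective _ w.symm.injective,
      Finset.card_image_of_injective _ u.symm.injective])
  have hmem : a ∈ (Finset.Iio (w a)).image u.symm :=
    Finset.mem_image.2 ⟨u a, Finset.mem_Iio.2 ha, u.symm_apply_apply a⟩
  rw [← heq] at hmem
  simp [Equiv.symm_apply_eq] at hmem

theorem eq_of_lt_minimal {k : ℕ} {u w : Equiv.Perm ℕ+} (hcond : condIandII k u w) {a : ℕ+}
    (hmin : ∀ a' : ℕ+, (a' : ℕ) ≤ k → u a' < w a' → u a ≤ u a') :
    ∀ i, u i < u a → w i = u i := by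
  refine eq_of_forall_le_of_lt (u a) fun i hi => ?_
  rcases le_or_gt (i : ℕ) k with hk | hk
  · by_contra h
    exact absurd (hmin i hk (not_le.mp h)) (not_le.mpr hi)
  · exact hcond.2.1 i hk

theorem le_of_lt_minimal {k : ℕ} {u w : Equiv.Perm ℕ+} (hcond : condIandII k u w) {a b : ℕ+}
    (hmin : ∀ a' : ℕ+, (a' : ℕ) ≤ k → u a' < w a' → u a ≤ u a')
    (hwb : w b < w a) (hub : w a ≤ u b) : u a ≤ w b := by
  by_contra! h
  have h1 := eq_of_lt_minimal hcond hmin (u.symm (w b)) (by simpa using h)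
  rw [Equiv.apply_symm_apply] at h1
  have h2 := w.injective h1
  rw [Equiv.symm_apply_eq] at h2
  exact absurd (hwb.trans_le hub) (by rw [h2]; exact lt_irrefl _)

theorem no_intermediate_of_condIandII {k : ℕ} {u w : Equiv.Perm ℕ+}
    (hcond : condIandII k u w) {a b : ℕ+}
    (hmin : ∀ a' : ℕ+, (a' : ℕ) ≤ k → u a' < w a' → u a ≤ u a')
    (hwb : w b < w a) (hub : w a ≤ u b)
    (hmax : ∀ b' : ℕ+, k < (b' : ℕ) → w b' < w a → w a ≤ u b' → u b' ≤ u b) :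
    ∀ c, a < c → c < b → w b < w c → ¬ w c < w a := by
  intro c hac hcb hbc hca
  have hle := le_of_lt_minimal hcond hmin hwb hub
  rcases le_or_gt (c : ℕ) k with hk | hk
  · rcases lt_or_gt_of_ne (fun h => hac.ne (u.injective h) : u a ≠ u c) with h | h
    · have := (hcond.2.2 a c hac h hca).2
      omega
    · have := eq_of_lt_minimal hcond hmin c h
      order
  · rcases lt_or_gt_of_ne (fun h => hcb.ne (u.injective h) : u c ≠ u b) with h | h
    · have := (hcond.2.2 c b hcb h hbc).1
      omega
    · exact absurd (hmax c hk hca (hub.trans h.le)) (not_le.mpr h)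

theorem condIandII.mul_swap {k : ℕ} {u w : Equiv.Perm ℕ+}
    (hcond : condIandII k u w) {a b : ℕ+} (hak : (a : ℕ) ≤ k)
    (hmin : ∀ a' : ℕ+, (a' : ℕ) ≤ k → u a' < w a' → u a ≤ u a')
    (hbk : k < (b : ℕ)) (hwb : w b < w a) (hub : w a ≤ u b)
    (hmax : ∀ b' : ℕ+, k < (b' : ℕ) → w b' < w a → w a ≤ u b' → u b' ≤ u b) :
    condIandII k u (w * Equiv.swap a b) := by
  have hle := le_of_lt_minimal hcond hmin hwb hub
  have hab : a < b := PNat.coe_lt_coe _ _ |>.1 (hak.trans_lt hbk)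
  have hA : (w * Equiv.swap a b) a = w b := by simp
  have hB : (w * Equiv.swap a b) b = w a := by simp
  have hO : ∀ i, i ≠ a → i ≠ b → (w * Equiv.swap a b) i = w i := fun i h1 h2 => by
    simp [Equiv.swap_apply_of_ne_of_ne h1 h2]
  refine ⟨fun i hi => ?_, fun i hi => ?_, fun i j hij huij hwij => ?_⟩
  · by_cases hia : i = a
    · rw [hia, hA]
      exact hle
    · rw [hO i hia (by rintro rfl; omega)]
      exact hcond.1 i hi
  · by_cases hib : i = b
    · rw [hib, hB]
      exact hub
    · rw [hO i (by rintro rfl; omega) hib]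
      exact hcond.2.1 i hi
  · by_cases hia : i = a
    · subst hia
      by_cases hjb : j = b
      · subst hjb
        exact ⟨hak, hbk⟩
      · rw [hA, hO j hij.ne' hjb] at hwij
        exact hcond.2.2 i j hij huij (hwij.trans hwb)
    by_cases hib : i = b
    · subst hib
      rw [hB, hO j (hab.trans hij).ne' hij.ne'] at hwij
      have hjk : k < (j : ℕ) := hbk.trans (PNat.coe_lt_coe _ _ |>.2 hij)
      exact absurd (hmax j hjk hwij (hub.trans huij.le)) (not_le.mpr huij)
    rw [hO i hia hib] at hwij
    by_cases hja : j = a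
    · subst hja
      rw [hA] at hwij
      have := eq_of_lt_minimal hcond hmin i huij
      order
    by_cases hjb : j = b
    · subst hjb
      rw [hB] at hwij
      exact hcond.2.2 i j hij huij (hwb.trans hwij)
    rw [hO j hja hjb] at hwij
    exact hcond.2.2 i j hij huij hwij

theorem kBruhatCover_mul_swap {k : ℕ} {u w : Equiv.Perm ℕ+} (hw : finSupp w)
    (hcond : condIandII k u w) {a b : ℕ+} (hak : (a : ℕ) ≤ k)
    (hmin : ∀ a' : ℕ+, (a' : ℕ) ≤ k → u a' < w a' → u a ≤ u a')
    (hbk : k < (b : ℕ)) (hwb : w b < w a) (hub : w a ≤ u b)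
    (hmax : ∀ b' : ℕ+, k < (b' : ℕ) → w b' < w a → w a ≤ u b' → u b' ≤ u b) :
    kBruhatCover k (w * Equiv.swap a b) w :=
  ⟨a, b, hak, hbk, by simp [mul_assoc],
    len_eq_len_mul_swap_add_one hw (PNat.coe_lt_coe _ _ |>.1 (hak.trans_lt hbk)) hwb
      (no_intermediate_of_condIandII hcond hmin hwb hub hmax)⟩

theorem exists_kBruhatCover_of_condIandII {k : ℕ} {u w : Equiv.Perm ℕ+} (hw : finSupp w)
    (hne : u ≠ w) (hcond : condIandII k u w) :
    ∃ v, finSupp v ∧ kBruhatCover k v w ∧ condIandII k u v := by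
  obtain ⟨a, ⟨hak, ha⟩, hmin⟩ := exists_minimalFor_of_wellFoundedLT
    (fun a : ℕ+ => (a : ℕ) ≤ k ∧ u a < w a) u (exists_lt_of_condIandII hne hcond)
  replace hmin : ∀ a' : ℕ+, (a' : ℕ) ≤ k → u a' < w a' → u a ≤ u a' := fun a' h1 h2 =>
    le_of_not_gt fun h => absurd (hmin ⟨h1, h2⟩ h.le) (not_le.mpr h)
  have hfin : {b : ℕ+ | k < (b : ℕ) ∧ w b < w a ∧ w a ≤ u b}.Finite :=
    ((Set.finite_Iio (w a)).preimage w.injective.injOn).subset fun b hb => hb.2.1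
  obtain ⟨b, ⟨hbk, hwb, hub⟩, hmax⟩ := Set.exists_max_image _ u hfin
    (exists_lt_le_of_condIandII hcond ha)
  replace hmax := fun b' h1 h2 h3 => hmax b' ⟨h1, h2, h3⟩
  exact ⟨w * Equiv.swap a b, hw.mul_swap a b,
    kBruhatCover_mul_swap hw hcond hak hmin hbk hwb hub hmax,
    hcond.mul_swap hak hmin hbk hwb hub hmax⟩

theorem exists_saturated_chain_of_condIandII {k : ℕ} {u w : Equiv.Perm ℕ+} (hw : finSupp w)
    (hcond : condIandII k u w) :
    len u ≤ len w ∧ ∃ c : ℕ → Equiv.Perm ℕ+, c 0 = u ∧ c (len w - len u) = w ∧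
      ∀ i, i < len w - len u → kBruhatCover k (c i) (c (i + 1)) := by
  induction hn : len w generalizing w with
  | zero =>
    have huw : u = w := by
      by_contra hne
      obtain ⟨v, -, ⟨-, -, -, -, -, hl⟩, -⟩ := exists_kBruhatCover_of_condIandII hw hne hcond
      omega
    subst huw
    exact ⟨hn.le, fun _ => u, rfl, rfl, fun i hi => by omega⟩
  | succ n ih =>
    by_cases hne : u = w
    · subst hne
      exact ⟨hn.le, fun _ => u, rfl, rfl, fun i hi => by omega⟩
    obtain ⟨v, hv, hcov, hcv⟩ := exists_kBruhatCover_of_condIandII hw hne hcond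
    have hl : len w = len v + 1 := by
      obtain ⟨-, -, -, -, -, hl⟩ := hcov
      exact hl
    obtain ⟨hle, c, hc0, hcn, hc⟩ := ih hv hcv (by omega)
    have hsub : n + 1 - len u = (n - len u) + 1 := by omega
    refine ⟨by omega, fun i => if i ≤ n - len u then c i else w, by simp [hc0], ?_, ?_⟩
    · simp [hsub]
    · intro i hi
      rcases (Nat.lt_succ_iff_lt_or_eq.1 (hsub ▸ hi)) with h | h
      · simpa [h.le, Nat.succ_le_of_lt h] using hc i h
      · simpa [h, hcn] using hcov

/-- Algorithm 3.1: one step of the chain-producing algorithm, and the resulting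
saturated chain in the `k`-Bruhat order from `u` to `w` of length `ℓ(w) − ℓ(u)`. -/
theorem stmt1 (k : ℕ) (hk : 0 < k) (u w : Equiv.Perm ℕ+)
    (hu : finSupp u) (hw : finSupp w) (hne : u ≠ w) (hcond : condIandII k u w) :
    (∃ a : ℕ+, (a : ℕ) ≤ k ∧ u a < w a) ∧
    (∀ a : ℕ+, (a : ℕ) ≤ k → u a < w a →
      (∀ a' : ℕ+, (a' : ℕ) ≤ k → u a' < w a' → u a ≤ u a') →
      (∃ b : ℕ+, k < (b : ℕ) ∧ w b < w a ∧ w a ≤ u b) ∧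
      (∀ b : ℕ+, k < (b : ℕ) → w b < w a → w a ≤ u b →
        (∀ b' : ℕ+, k < (b' : ℕ) → w b' < w a → w a ≤ u b' → u b' ≤ u b) →
        kBruhatCover k (w * Equiv.swap a b) w ∧
        len (w * Equiv.swap a b) = len w - 1 ∧
        condIandII k u (w * Equiv.swap a b))) ∧
    (∃ c : ℕ → Equiv.Perm ℕ+, c 0 = u ∧ c (len w - len u) = w ∧
      ∀ i, i < len w - len u → kBruhatCover k (c i) (c (i + 1))) := by
  refine ⟨exists_lt_of_condIandII hne hcond, fun a hak ha hmin =>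
    ⟨exists_lt_le_of_condIandII hcond ha, fun b hbk hwb hub hmax => ?_⟩,
    (exists_saturated_chain_of_condIandII hw hcond).2⟩
  have hcov := kBruhatCover_mul_swap hw hcond hak hmin hbk hwb hub hmax
  refine ⟨hcov, ?_, hcond.mul_swap hak hmin hbk hwb hub hmax⟩
  obtain ⟨-, -, -, -, -, hl⟩ := hcov
  omega
end

section
/- The relation ≼ is a partial order on S_∞ (reflexive, antisymmetric, transitive) in which the identity e is the minimum element (e ≼ ζ for every ζ ∈ S_∞), and it is graded with rank function ζ ↦ |ζ|: one has |e| = 0, and whenever η ≼ ζ there is a chain η = ξ_0 ≺ ξ_1 ≺ ⋯ ≺ ξ_m = ζ with |ξ_{i+1}| = |ξ_i| + 1 for all i (hence m = |ζ| − |η|, and every cover relation in ≼ raises |·| by exactly 1). -/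
/-- The rank `|ζ|` as an integer. -/
noncomputable def zlen (ζ : Equiv.Perm ℕ+) : ℤ :=
  ({p : ℕ+ × ℕ+ | p.1 ∈ (⇑ζ) '' {α | α < ζ α} ∧ p.2 ∈ (⇑ζ) '' {β | ζ β < β} ∧ p.2 < p.1}.ncard : ℤ)
    - ({p : ℕ+ × ℕ+ | p.1 < ζ p.1 ∧ p.2 < ζ p.2 ∧ p.2 < p.1 ∧ ζ p.1 < ζ p.2}.ncard : ℤ)
    - ({p : ℕ+ × ℕ+ | ζ p.1 < p.1 ∧ ζ p.2 < p.2 ∧ p.2 < p.1 ∧ ζ p.1 < ζ p.2}.ncard : ℤ)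
    - ({p : ℕ+ × ℕ+ | p.1 < ζ p.1 ∧ ζ p.2 < p.2 ∧ p.2 < p.1}.ncard : ℤ)

/-- The relation `≼` on `S_∞`: `η ≼ ζ` iff there exist a positive integer `k`
and `u ∈ S_∞` with `u ≤_k η∘u ≤_k ζ∘u`. -/
def preceq (η ζ : Equiv.Perm ℕ+) : Prop :=
  ∃ k : ℕ, 0 < k ∧ ∃ u : Equiv.Perm ℕ+, finSupp u ∧
    kBruhatLE k u (η * u) ∧ kBruhatLE k (η * u) (ζ * u)

set_option maxHeartbeats 4000000 in
theorem pair_identity (x y zx zy p q k : ℤ) (hz : zx = zy ↔ x = y) (hp : p = q ↔ x = y)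
    (hx1 : p ≤ k → x ≤ zx) (hx2 : k < p → zx ≤ x)
    (hy1 : q ≤ k → y ≤ zy) (hy2 : k < q → zy ≤ y)
    (hxy : p < q → x < y → zy < zx → p ≤ k ∧ k < q)
    (hyx : q < p → y < x → zx < zy → q ≤ k ∧ k < p) :
    ((if p < q ∧ zy < zx then (1 : ℤ) else 0) - (if p < q ∧ y < x then 1 else 0)) +
    ((if q < p ∧ zx < zy then (1 : ℤ) else 0) - (if q < p ∧ x < y then 1 else 0)) =
    ((if x < zx ∧ zy < y ∧ zy < zx then (1 : ℤ) else 0)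
      - (if x < zx ∧ y < zy ∧ y < x ∧ zx < zy then 1 else 0)
      - (if zx < x ∧ zy < y ∧ y < x ∧ zx < zy then 1 else 0)
      - (if x < zx ∧ zy < y ∧ y < x then 1 else 0)) +
    ((if y < zy ∧ zx < x ∧ zx < zy then (1 : ℤ) else 0)
      - (if y < zy ∧ x < zx ∧ x < y ∧ zy < zx then 1 else 0)
      - (if zy < y ∧ zx < x ∧ x < y ∧ zy < zx then 1 else 0)
      - (if y < zy ∧ zx < x ∧ x < y then 1 else 0)) +
    ((if zx = x then (if p ≤ k then (1 : ℤ) else -1) else 0) *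
      ((if zy < x then 1 else 0) - (if y < x then 1 else 0)) +
     (if zy = y then (if q ≤ k then (1 : ℤ) else -1) else 0) *
      ((if zx < y then 1 else 0) - (if x < y then 1 else 0))) := by
  rcases lt_or_ge k p with h1 | h1 <;> rcases lt_or_ge k q with h2 | h2 <;>
  rcases lt_trichotomy x y with h3 | h3 | h3 <;>
  rcases lt_trichotomy zx x with h4 | h4 | h4 <;>
  rcases lt_trichotomy zy y with h5 | h5 | h5 <;>
  rcases lt_trichotomy p q with h6 | h6 | h6 <;>
  first
  | (exfalso; omega)
  | grind

theorem pair_identity_pnat (x y zx zy p q : ℕ+) (k : ℕ) (hz : zx = zy ↔ x = y)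
    (hp : p = q ↔ x = y)
    (hx1 : (p : ℕ) ≤ k → x ≤ zx) (hx2 : k < (p : ℕ) → zx ≤ x)
    (hy1 : (q : ℕ) ≤ k → y ≤ zy) (hy2 : k < (q : ℕ) → zy ≤ y)
    (hxy : p < q → x < y → zy < zx → (p : ℕ) ≤ k ∧ k < (q : ℕ))
    (hyx : q < p → y < x → zx < zy → (q : ℕ) ≤ k ∧ k < (p : ℕ)) :
    ((if p < q ∧ zy < zx then (1 : ℤ) else 0) - (if p < q ∧ y < x then 1 else 0)) +
    ((if q < p ∧ zx < zy then (1 : ℤ) else 0) - (if q < p ∧ x < y then 1 else 0)) =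
    ((if x < zx ∧ zy < y ∧ zy < zx then (1 : ℤ) else 0)
      - (if x < zx ∧ y < zy ∧ y < x ∧ zx < zy then 1 else 0)
      - (if zx < x ∧ zy < y ∧ y < x ∧ zx < zy then 1 else 0)
      - (if x < zx ∧ zy < y ∧ y < x then 1 else 0)) +
    ((if y < zy ∧ zx < x ∧ zx < zy then (1 : ℤ) else 0)
      - (if y < zy ∧ x < zx ∧ x < y ∧ zy < zx then 1 else 0)
      - (if zy < y ∧ zx < x ∧ x < y ∧ zy < zx then 1 else 0)
      - (if y < zy ∧ zx < x ∧ x < y then 1 else 0)) +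
    ((if zx = x then (if (p : ℕ) ≤ k then (1 : ℤ) else -1) else 0) *
      ((if zy < x then 1 else 0) - (if y < x then 1 else 0)) +
     (if zy = y then (if (q : ℕ) ≤ k then (1 : ℤ) else -1) else 0) *
      ((if zx < y then 1 else 0) - (if x < y then 1 else 0))) := by
  have lt (a b : ℕ+) : a < b ↔ ((a : ℕ) : ℤ) < ((b : ℕ) : ℤ) := by norm_cast
  have le (a b : ℕ+) : a ≤ b ↔ ((a : ℕ) : ℤ) ≤ ((b : ℕ) : ℤ) := by norm_cast
  have eq (a b : ℕ+) : a = b ↔ ((a : ℕ) : ℤ) = ((b : ℕ) : ℤ) := by norm_cast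
  simp only [lt, le, eq, ← Nat.cast_lt (α := ℤ), ← Nat.cast_le (α := ℤ)] at *
  exact pair_identity _ _ _ _ _ _ _ hz hp hx1 hx2 hy1 hy2 hxy hyx

/-- Number of pairs satisfying a relation that forces both entries into a finite set. -/
theorem ncard_pairs_eq_sum (S : Finset ℕ+) (P : ℕ+ → ℕ+ → Prop) [∀ x y, Decidable (P x y)]
    (h : ∀ x y, P x y → x ∈ S ∧ y ∈ S) :
    ({p : ℕ+ × ℕ+ | P p.1 p.2}.ncard : ℤ) =
      ∑ x ∈ S, ∑ y ∈ S, if P x y then (1 : ℤ) else 0 := by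
  have : {p : ℕ+ × ℕ+ | P p.1 p.2} = ↑((S ×ˢ S).filter fun p => P p.1 p.2) := by
    ext ⟨x, y⟩
    simpa using h x y
  rw [this, Set.ncard_coe_finset, Finset.card_filter, Finset.sum_product]
  push_cast
  rfl

theorem exists_bound {u : Equiv.Perm ℕ+} (hu : finSupp u) : ∃ N : ℕ+, ∀ x, N < x → u x = x := by
  obtain ⟨N, hN⟩ := hu.bddAbove
  refine ⟨N, fun x hx => ?_⟩
  by_contra h
  exact absurd (hN h) (not_le.mpr hx)

theorem apply_le_iff {u : Equiv.Perm ℕ+} {N : ℕ+} (hN : ∀ x, N < x → u x = x) (x : ℕ+) :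
    u x ≤ N ↔ x ≤ N := by
  constructor
  · intro h
    by_contra hx
    rw [hN x (not_le.mp hx)] at h
    exact hx h
  · intro h
    by_contra hx
    have := u.injective (hN _ (not_le.mp hx))
    rw [this] at hx
    exact hx h

theorem finSupp.mul {u v : Equiv.Perm ℕ+} (hu : finSupp u) (hv : finSupp v) :
    finSupp (u * v) := by
  refine (hu.union hv).subset fun x hx => ?_
  by_contra h
  simp only [Set.mem_union, Set.mem_ofPred_eq, not_or, not_not] at h
  exact hx (by rw [Equiv.Perm.mul_apply, h.2, h.1])

theorem finSupp.inv {u : Equiv.Perm ℕ+} (hu : finSupp u) : finSupp u⁻¹ := by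
  refine hu.subset fun x hx h => hx ?_
  rw [Equiv.Perm.inv_eq_iff_eq]
  exact h.symm

theorem finSupp_swap (a b : ℕ+) : finSupp (Equiv.swap a b) := by
  refine (Set.toFinite {a, b}).subset fun x hx => ?_
  by_contra h
  simp only [Set.mem_insert_iff, Set.mem_singleton_iff, not_or] at h
  exact hx (Equiv.swap_apply_of_ne_of_ne h.1 h.2)

theorem len_eq_sum {u v : Equiv.Perm ℕ+} {N : ℕ+} (hu : ∀ x, N < x → u x = x)
    (hv : ∀ x, N < x → v x = x) :
    (len (v * u) : ℤ) = ∑ x ∈ Finset.Icc 1 N, ∑ y ∈ Finset.Icc 1 N,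
      if u⁻¹ x < u⁻¹ y ∧ v y < v x then (1 : ℤ) else 0 := by
  have hset : {p : ℕ+ × ℕ+ | p.1 < p.2 ∧ (v * u) p.2 < (v * u) p.1} =
      (Prod.map (u⁻¹ : Equiv.Perm ℕ+) (u⁻¹ : Equiv.Perm ℕ+)) ''
        {p : ℕ+ × ℕ+ | u⁻¹ p.1 < u⁻¹ p.2 ∧ v p.2 < v p.1} := by
    ext ⟨a, b⟩
    constructor
    · intro h
      exact ⟨(u a, u b), by simpa using h, by simp⟩
    · rintro ⟨⟨x, y⟩, h, hxy⟩
      simp only [Prod.map_apply, Prod.mk.injEq] at hxy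
      obtain ⟨rfl, rfl⟩ := hxy
      simpa using h
  have hu' : ∀ x, N < x → u⁻¹ x = x := fun x hx => by
    rw [Equiv.Perm.inv_eq_iff_eq, hu x hx]
  unfold len
  rw [hset, Set.ncard_image_of_injective _ (Prod.map_injective.mpr
    ⟨Equiv.injective _, Equiv.injective _⟩)]
  refine ncard_pairs_eq_sum (Finset.Icc 1 N) (fun x y => u⁻¹ x < u⁻¹ y ∧ v y < v x) ?_
  intro x y h
  simp only [Finset.mem_Icc, one_le, true_and]
  have hux := apply_le_iff hu' x
  have huy := apply_le_iff hu' y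
  have hvx := apply_le_iff hv x
  have hvy := apply_le_iff hv y
  have h1 := hu' x
  have h2 := hu' y
  have h3 := hv x
  have h4 := hv y
  rcases le_or_gt x N with hx | hx <;> rcases le_or_gt y N with hy | hy
  · exact ⟨hx, hy⟩
  · exact absurd ((hvx.mpr hx).trans_lt hy) (by rw [← h4 hy]; exact not_lt.mpr h.2.le)
  · exact absurd ((huy.mpr hy).trans_lt hx) (by rw [← h1 hx]; exact not_lt.mpr h.1.le)
  · rw [h1 hx, h2 hy, h3 hx, h4 hy] at h
    exact absurd h.1 (not_lt.mpr h.2.le)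

theorem zlen_eq_sum {ζ : Equiv.Perm ℕ+} {N : ℕ+} (hζ : ∀ x, N < x → ζ x = x) :
    zlen ζ = ∑ x ∈ Finset.Icc 1 N, ∑ y ∈ Finset.Icc 1 N,
      ((if x < ζ x ∧ ζ y < y ∧ ζ y < ζ x then (1 : ℤ) else 0)
      - (if x < ζ x ∧ y < ζ y ∧ y < x ∧ ζ x < ζ y then 1 else 0)
      - (if ζ x < x ∧ ζ y < y ∧ y < x ∧ ζ x < ζ y then 1 else 0)
      - (if x < ζ x ∧ ζ y < y ∧ y < x then 1 else 0)) := by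
  have hset : {p : ℕ+ × ℕ+ | p.1 ∈ (⇑ζ) '' {α | α < ζ α} ∧ p.2 ∈ (⇑ζ) '' {β | ζ β < β} ∧
      p.2 < p.1} = (Prod.map ζ ζ) '' {p : ℕ+ × ℕ+ | p.1 < ζ p.1 ∧ ζ p.2 < p.2 ∧
        ζ p.2 < ζ p.1} := by
    ext ⟨a, b⟩
    constructor
    · rintro ⟨⟨x, hx, rfl⟩, ⟨y, hy, rfl⟩, h⟩
      exact ⟨(x, y), ⟨hx, hy, h⟩, rfl⟩
    · rintro ⟨⟨x, y⟩, ⟨hx, hy, h⟩, hxy⟩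
      simp only [Prod.map_apply, Prod.mk.injEq] at hxy
      obtain ⟨rfl, rfl⟩ := hxy
      exact ⟨⟨x, hx, rfl⟩, ⟨y, hy, rfl⟩, h⟩
  have hmem : ∀ x, ζ x ≠ x → x ∈ Finset.Icc 1 N := fun x hx => by
    simp only [Finset.mem_Icc, one_le, true_and]
    by_contra h
    exact hx (hζ x (not_le.mp h))
  unfold zlen
  rw [hset, Set.ncard_image_of_injective _ (Prod.map_injective.mpr
    ⟨Equiv.injective _, Equiv.injective _⟩)]
  simp only [Finset.sum_sub_distrib]
  rw [ncard_pairs_eq_sum (Finset.Icc 1 N) (fun x y => x < ζ x ∧ ζ y < y ∧ ζ y < ζ x)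
      fun x y h => ⟨hmem x h.1.ne', hmem y h.2.1.ne⟩,
    ncard_pairs_eq_sum (Finset.Icc 1 N) (fun x y => x < ζ x ∧ y < ζ y ∧ y < x ∧ ζ x < ζ y)
      fun x y h => ⟨hmem x h.1.ne', hmem y h.2.1.ne'⟩,
    ncard_pairs_eq_sum (Finset.Icc 1 N) (fun x y => ζ x < x ∧ ζ y < y ∧ y < x ∧ ζ x < ζ y)
      fun x y h => ⟨hmem x h.1.ne, hmem y h.2.1.ne⟩,
    ncard_pairs_eq_sum (Finset.Icc 1 N) (fun x y => x < ζ x ∧ ζ y < y ∧ y < x)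
      fun x y h => ⟨hmem x h.1.ne', hmem y h.2.1.ne⟩]

/-- The pointwise criterion for comparability of `u` and `w` in the `k`-Bruhat order. -/
structure Compat (k : ℕ) (u w : Equiv.Perm ℕ+) : Prop where
  le_left : ∀ a : ℕ+, (a : ℕ) ≤ k → u a ≤ w a
  le_right : ∀ a : ℕ+, k < (a : ℕ) → w a ≤ u a
  inversion : ∀ a b : ℕ+, a < b → u a < u b → w b < w a → (a : ℕ) ≤ k ∧ k < (b : ℕ)

theorem sum_fixed_eq_zero {ζ : Equiv.Perm ℕ+} {N : ℕ+} (hζ : ∀ x, N < x → ζ x = x)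
    (x : ℕ+) :
    ∑ y ∈ Finset.Icc 1 N, ((if ζ y < x then (1 : ℤ) else 0) - (if y < x then 1 else 0)) = 0 := by
  rw [Finset.sum_sub_distrib, sub_eq_zero]
  refine Finset.sum_equiv ζ (fun y => ?_) fun y _ => rfl
  simp only [Finset.mem_Icc, one_le, true_and]
  exact (apply_le_iff hζ y).symm

theorem Compat.len_mul {k : ℕ} {u ζ : Equiv.Perm ℕ+} (hu : finSupp u) (hζ : finSupp ζ)
    (h : Compat k u (ζ * u)) : (len (ζ * u) : ℤ) = len u + zlen ζ := by
  obtain ⟨N₁, h₁⟩ := exists_bound hu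
  obtain ⟨N₂, h₂⟩ := exists_bound hζ
  set N := max N₁ N₂
  replace h₁ : ∀ x, N < x → u x = x := fun x hx => h₁ x ((le_max_left _ _).trans_lt hx)
  replace h₂ : ∀ x, N < x → ζ x = x := fun x hx => h₂ x ((le_max_right _ _).trans_lt hx)
  have hlen := len_eq_sum (v := 1) h₁ fun x _ => rfl
  simp only [one_mul, Equiv.Perm.one_apply] at hlen
  set S := Finset.Icc 1 N
  set T : ℕ+ → ℕ+ → ℤ := fun x y =>
    (if u⁻¹ x < u⁻¹ y ∧ ζ y < ζ x then (1 : ℤ) else 0) -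
      (if u⁻¹ x < u⁻¹ y ∧ y < x then 1 else 0) with hT
  set G : ℕ+ → ℕ+ → ℤ := fun x y =>
    ((if x < ζ x ∧ ζ y < y ∧ ζ y < ζ x then (1 : ℤ) else 0)
      - (if x < ζ x ∧ y < ζ y ∧ y < x ∧ ζ x < ζ y then 1 else 0)
      - (if ζ x < x ∧ ζ y < y ∧ y < x ∧ ζ x < ζ y then 1 else 0)
      - (if x < ζ x ∧ ζ y < y ∧ y < x then 1 else 0)) with hG
  set H : ℕ+ → ℕ+ → ℤ := fun x y =>
    (if ζ x = x then (if (u⁻¹ x : ℕ) ≤ k then (1 : ℤ) else -1) else 0) *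
      ((if ζ y < x then 1 else 0) - (if y < x then 1 else 0)) with hH
  have key : ∀ x y, T x y + T y x = G x y + G y x + (H x y + H y x) := by
    intro x y
    refine pair_identity_pnat x y (ζ x) (ζ y) (u⁻¹ x) (u⁻¹ y) k ζ.injective.eq_iff
      (Equiv.injective _).eq_iff ?_ ?_ ?_ ?_ ?_ ?_
    · simpa using h.le_left (u⁻¹ x)
    · simpa using h.le_right (u⁻¹ x)
    · simpa using h.le_left (u⁻¹ y)
    · simpa using h.le_right (u⁻¹ y)
    · simpa using h.inversion (u⁻¹ x) (u⁻¹ y)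
    · simpa using h.inversion (u⁻¹ y) (u⁻¹ x)
  have hH0 : ∑ x ∈ S, ∑ y ∈ S, H x y = 0 := by
    refine Finset.sum_eq_zero fun x _ => ?_
    simp only [hH]
    rw [← Finset.mul_sum, sum_fixed_eq_zero h₂, mul_zero]
  have hsum : ∑ x ∈ S, ∑ y ∈ S, (T x y + T y x) =
      ∑ x ∈ S, ∑ y ∈ S, (G x y + G y x + (H x y + H y x)) :=
    Finset.sum_congr rfl fun x _ => Finset.sum_congr rfl fun y _ => key x y
  simp only [Finset.sum_add_distrib] at hsum
  rw [Finset.sum_comm (f := fun x y => T y x), Finset.sum_comm (f := fun x y => G y x),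
    Finset.sum_comm (f := fun x y => H y x), hH0] at hsum
  have hTsum : ∑ x ∈ S, ∑ y ∈ S, T x y = (len (ζ * u) : ℤ) - len u := by
    rw [len_eq_sum h₁ h₂, hlen]
    simp only [hT, Finset.sum_sub_distrib]
    congr!
  have hGsum : ∑ x ∈ S, ∑ y ∈ S, G x y = zlen ζ := (zlen_eq_sum h₂).symm
  linarith

theorem zlen_swap {α β : ℕ+} (h : α < β) : zlen (Equiv.swap α β) = 1 := by
  have hup : ∀ x, x < Equiv.swap α β x ↔ x = α := by
    intro x
    rw [Equiv.swap_apply_def]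
    split_ifs <;> grind
  have hdown : ∀ x, Equiv.swap α β x < x ↔ x = β := by
    intro x
    rw [Equiv.swap_apply_def]
    split_ifs <;> grind
  unfold zlen
  simp only [hup, hdown, Set.ofPred_eq_eq_singleton, Set.image_singleton, Equiv.swap_apply_left,
    Equiv.swap_apply_right, Set.mem_singleton_iff]
  have h1 : {p : ℕ+ × ℕ+ | p.1 = β ∧ p.2 = α ∧ p.2 < p.1} = {(β, α)} := by
    ext ⟨x, y⟩; simp only [Set.mem_ofPred_eq, Set.mem_singleton_iff, Prod.mk.injEq]; grind
  have h2 : {p : ℕ+ × ℕ+ | p.1 = α ∧ p.2 = α ∧ p.2 < p.1 ∧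
      Equiv.swap α β p.1 < Equiv.swap α β p.2} = ∅ := by
    ext ⟨x, y⟩; simp only [Set.mem_ofPred_eq, Set.mem_empty_iff_false]; grind
  have h3 : {p : ℕ+ × ℕ+ | p.1 = β ∧ p.2 = β ∧ p.2 < p.1 ∧
      Equiv.swap α β p.1 < Equiv.swap α β p.2} = ∅ := by
    ext ⟨x, y⟩; simp only [Set.mem_ofPred_eq, Set.mem_empty_iff_false]; grind
  have h4 : {p : ℕ+ × ℕ+ | p.1 = α ∧ p.2 = β ∧ p.2 < p.1} = ∅ := by
    ext ⟨x, y⟩; simp only [Set.mem_ofPred_eq, Set.mem_empty_iff_false]; grind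
  rw [h1, h2, h3, h4]
  simp

theorem mul_swap_apply (u : Equiv.Perm ℕ+) (a b x : ℕ+) :
    (u * Equiv.swap a b) x = if x = a then u b else if x = b then u a else u x := by
  rw [Equiv.Perm.mul_apply, Equiv.swap_apply_def]
  split_ifs <;> rfl

theorem compat_mul_swap {k : ℕ} {u : Equiv.Perm ℕ+} {a b : ℕ+} (hak : (a : ℕ) ≤ k)
    (hkb : k < (b : ℕ)) (hu : u a < u b)
    (hc : ∀ c, a < c → c < b → u a < u c → ¬ u c < u b) :
    Compat k u (u * Equiv.swap a b) := by
  have hinj : ∀ x y, u x = u y → x = y := fun x y h => u.injective h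
  refine ⟨fun x hx => ?_, fun x hx => ?_, fun x y hxy h1 h2 => ?_⟩
  · rw [mul_swap_apply]
    split_ifs with h h'
    · exact h ▸ hu.le
    · subst h'; omega
    · exact le_rfl
  · rw [mul_swap_apply]
    split_ifs with h h'
    · subst h; omega
    · exact h' ▸ hu.le
    · exact le_rfl
  · rw [mul_swap_apply, mul_swap_apply] at h2
    have hxy' : (x : ℕ) < y := hxy
    have hca := hc x
    have hcb := hc y
    have e1 := hinj x a
    have e2 := hinj x b
    have e3 := hinj y a
    have e4 := hinj y b
    have l1 : ∀ s t : ℕ+, s < t ↔ (s : ℕ) < t := fun s t => Iff.rfl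
    have l2 : ∀ s t : ℕ+, s = t ↔ (s : ℕ) = t := fun s t => PNat.coe_inj.symm
    split_ifs at h2 <;> subst_vars <;> simp only [l1, l2] at * <;> omega

theorem len_mul_swap_of_not_between {u : Equiv.Perm ℕ+} (hfin : finSupp u) {a b : ℕ+}
    (hab : a < b) (hu : u a < u b) (hc : ∀ c, a < c → c < b → u a < u c → ¬ u c < u b) :
    len (u * Equiv.swap a b) = len u + 1 := by
  have h := compat_mul_swap (k := a) le_rfl hab hu hc
  rw [Equiv.mul_swap_eq_swap_mul] at h ⊢
  have := h.len_mul hfin (finSupp_swap _ _)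
  rw [zlen_swap hu] at this
  exact_mod_cast this

theorem swap_conj_step (u : Equiv.Perm ℕ+) {a b c : ℕ+} (hac : a ≠ c) (hbc : b ≠ c)
    (hab : a ≠ b) :
    u * Equiv.swap a b =
      u * Equiv.swap a c * Equiv.swap c b * Equiv.swap a c := by
  ext x
  simp only [Equiv.Perm.mul_apply, Equiv.swap_apply_def]
  grind

theorem len_lt_mul_swap_aux (n : ℕ) : ∀ {u : Equiv.Perm ℕ+} (_ : finSupp u) {a b : ℕ+},
    (b : ℕ) - a = n → a < b → u a < u b → len u < len (u * Equiv.swap a b) ∧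
      ((∃ c, a < c ∧ c < b ∧ u a < u c ∧ u c < u b) →
        len u + 1 < len (u * Equiv.swap a b)) := by
  induction n using Nat.strong_induction_on with
  | _ n ih =>
  intro u hfin a b hn hab hu
  by_cases hc : ∃ c, a < c ∧ c < b ∧ u a < u c ∧ u c < u b
  · obtain ⟨c, h1, h2, h3, h4⟩ := hc
    have h1' : (a : ℕ) < c := h1
    have h2' : (c : ℕ) < b := h2
    have s1 := (ih (c - a) (by omega) hfin rfl h1 h3).1
    have s2 := (ih (b - c) (by omega) (hfin.mul (finSupp_swap a c)) rfl h2
      (by rw [mul_swap_apply, mul_swap_apply]; grind)).1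
    have s3 := (ih (c - a) (by omega) ((hfin.mul (finSupp_swap a c)).mul (finSupp_swap c b)) rfl h1
      (by simp only [mul_swap_apply]; grind)).1
    rw [← swap_conj_step u h1.ne h2.ne' hab.ne] at s3
    exact ⟨by omega, fun _ => by omega⟩
  · refine ⟨?_, fun h => absurd h hc⟩
    push Not at hc
    rw [len_mul_swap_of_not_between hfin hab hu fun c h1 h2 h3 => not_lt.mpr (hc c h1 h2 h3)]
    exact Nat.lt_succ_self _

theorem len_lt_mul_swap {u : Equiv.Perm ℕ+} (hfin : finSupp u) {a b : ℕ+} (hab : a < b)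
    (hu : u a < u b) : len u < len (u * Equiv.swap a b) :=
  (len_lt_mul_swap_aux _ hfin rfl hab hu).1

theorem kBruhatCover_iff {k : ℕ} {u w : Equiv.Perm ℕ+} (hfin : finSupp u) :
    kBruhatCover k u w ↔ ∃ a b : ℕ+, (a : ℕ) ≤ k ∧ k < (b : ℕ) ∧ w = u * Equiv.swap a b ∧
      u a < u b ∧ ∀ c, a < c → c < b → u a < u c → ¬ u c < u b := by
  constructor
  · rintro ⟨a, b, hak, hkb, rfl, hlen⟩
    have hab : a < b := (lt_of_le_of_lt hak hkb : (a : ℕ) < b)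
    have hu : u a < u b := by
      by_contra h
      have hne : u a ≠ u b := fun h => hab.ne (u.injective h)
      have := len_lt_mul_swap (hfin.mul (finSupp_swap a b)) hab
        (by simpa using lt_of_le_of_ne (not_lt.mp h) hne.symm)
      rw [mul_assoc, Equiv.swap_mul_self, mul_one] at this
      omega
    refine ⟨a, b, hak, hkb, rfl, hu, fun c h1 h2 h3 h4 => ?_⟩
    have := (len_lt_mul_swap_aux _ hfin rfl hab hu).2 ⟨c, h1, h2, h3, h4⟩
    omega
  · rintro ⟨a, b, hak, hkb, rfl, hu, hc⟩
    have hab : a < b := (lt_of_le_of_lt hak hkb : (a : ℕ) < b)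
    exact ⟨a, b, hak, hkb, rfl, len_mul_swap_of_not_between hfin hab hu hc⟩

theorem kBruhatCover.finSupp_right {k : ℕ} {u w : Equiv.Perm ℕ+} (h : kBruhatCover k u w)
    (hu : finSupp u) : finSupp w := by
  obtain ⟨a, b, -, -, rfl, -⟩ := h
  exact hu.mul (finSupp_swap a b)

theorem Compat.of_cover {k : ℕ} {u v w : Equiv.Perm ℕ+} (hfin : finSupp u)
    (huv : kBruhatCover k u v) (h : Compat k v w) : Compat k u w := by
  obtain ⟨a, b, hak, hkb, rfl, hu, hc⟩ := (kBruhatCover_iff hfin).mp huv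
  have hinj : ∀ x y, u x = u y → x = y := fun x y h => u.injective h
  refine ⟨fun x hx => ?_, fun x hx => ?_, fun x y hxy h1 h2 => ?_⟩
  · refine le_trans ?_ (h.le_left x hx)
    exact (compat_mul_swap hak hkb hu hc).le_left x hx
  · refine (h.le_right x hx).trans ?_
    exact (compat_mul_swap hak hkb hu hc).le_right x hx
  · have hxy' : (x : ℕ) < y := hxy
    have hi := h.inversion x y hxy
    rw [mul_swap_apply, mul_swap_apply] at hi
    have hca := hc x
    have hcb := hc y
    have e1 := hinj x a
    have e2 := hinj x b
    have e3 := hinj y a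
    have e4 := hinj y b
    have l1 : ∀ s t : ℕ+, s < t ↔ (s : ℕ) < t := fun s t => Iff.rfl
    have l2 : ∀ s t : ℕ+, s = t ↔ (s : ℕ) = t := fun s t => PNat.coe_inj.symm
    split_ifs at hi <;> subst_vars <;> simp only [l1, l2] at * <;> omega

theorem kBruhatLE.compat {k : ℕ} {u w : Equiv.Perm ℕ+} (hfin : finSupp u)
    (h : kBruhatLE k u w) : Compat k u w := by
  induction h using Relation.ReflTransGen.head_induction_on with
  | refl => exact ⟨fun _ _ => le_rfl, fun _ _ => le_rfl, fun _ _ _ h h' => absurd h h'.asymm⟩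
  | head huv _ ih => exact (ih (huv.finSupp_right hfin)).of_cover hfin huv

/-- The transposition `(α, β)` can be split off from `ξ` on the right, lowering its rank by one. -/
structure Removable (ξ : Equiv.Perm ℕ+) (α β : ℕ+) : Prop where
  lt : α < β
  le_apply : β ≤ ξ α
  apply_le : ξ β ≤ α
  up : ∀ γ, α < γ → γ < β → γ < ξ γ → ξ γ < ξ α
  down : ∀ γ, α < γ → γ < β → ξ γ < γ → ξ β < ξ γ

theorem removable_of_cover {k : ℕ} {u v ξ : Equiv.Perm ℕ+} (hfin : finSupp u)
    (huv : kBruhatCover k u v) (h : Compat k v (ξ * u)) :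
    ∃ α β, v = Equiv.swap α β * u ∧ Removable ξ α β := by
  have h' := h.of_cover hfin huv
  obtain ⟨a, b, hak, hkb, rfl, hu, hc⟩ := (kBruhatCover_iff hfin).mp huv
  have hab : a < b := (lt_of_le_of_lt hak hkb : (a : ℕ) < b)
  refine ⟨u a, u b, Equiv.mul_swap_eq_swap_mul _ _ _, hu, ?_, ?_, ?_, ?_⟩
  · simpa using h.le_left a hak
  · simpa using h.le_right b hkb
  · intro γ h1 h2 h3
    obtain ⟨c, rfl⟩ := u.surjective γ
    have hck : (c : ℕ) ≤ k := by
      by_contra hk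
      exact absurd (h'.le_right c (not_le.mp hk)) (not_le.mpr h3)
    have hcb : c < b := (lt_of_le_of_lt hck hkb : (c : ℕ) < b)
    have hca : c < a := by
      rcases lt_trichotomy c a with h | h | h
      · exact h
      · subst h; exact absurd h1 (lt_irrefl _)
      · exact absurd h2 (hc c h hcb h1)
    by_contra hcon
    have hlt : ξ (u a) < ξ (u c) := lt_of_le_of_ne (not_lt.mp hcon) fun e =>
      hca.ne' (u.injective (ξ.injective e))
    have := (h.inversion c a hca (by rw [mul_swap_apply, mul_swap_apply]; grind) hlt).2
    omega
  · intro γ h1 h2 h3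
    obtain ⟨c, rfl⟩ := u.surjective γ
    have hck : k < (c : ℕ) := by
      by_contra hk
      exact absurd (h'.le_left c (not_lt.mp hk)) (not_le.mpr h3)
    have hac : a < c := (lt_of_le_of_lt hak hck : (a : ℕ) < c)
    have hbc : b < c := by
      rcases lt_trichotomy b c with h | h | h
      · exact h
      · subst h; exact absurd h2 (lt_irrefl _)
      · exact absurd h2 (hc c hac h h1)
    by_contra hcon
    have hlt : ξ (u c) < ξ (u b) := lt_of_le_of_ne (not_lt.mp hcon) fun e =>
      hbc.ne' (u.injective (ξ.injective e))
    have := (h.inversion b c hbc (by rw [mul_swap_apply, mul_swap_apply]; grind) hlt).1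
    omega

theorem Removable.cover {k : ℕ} {u ξ : Equiv.Perm ℕ+} {α β : ℕ+} (hfin : finSupp u)
    (h : Compat k u (ξ * u)) (hr : Removable ξ α β) :
    kBruhatCover k u (Equiv.swap α β * u) ∧ Compat k (Equiv.swap α β * u) (ξ * u) := by
  obtain ⟨a, rfl⟩ := u.surjective α
  obtain ⟨b, rfl⟩ := u.surjective β
  rw [← Equiv.mul_swap_eq_swap_mul]
  have hu := hr.lt
  have hbw := hr.le_apply
  have haw := hr.apply_le
  have hak : (a : ℕ) ≤ k := by
    by_contra hk
    exact absurd (h.le_right a (not_le.mp hk)) (not_le.mpr (hu.trans_le hbw))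
  have hkb : k < (b : ℕ) := by
    by_contra hk
    exact absurd (h.le_left b (not_lt.mp hk)) (not_le.mpr (haw.trans_lt hu))
  have hleft : ∀ c : ℕ+, (c : ℕ) ≤ k → u a < u c → u c < u b → ξ (u c) < ξ (u a) := by
    intro c hc h1 h2
    rcases (h.le_left c hc).lt_or_eq with h3 | h3
    · exact hr.up _ h1 h2 h3
    · exact h3.symm.trans_lt (h2.trans_le hbw)
  have hright : ∀ c : ℕ+, k < (c : ℕ) → u a < u c → u c < u b → ξ (u b) < ξ (u c) := by
    intro c hc h1 h2
    rcases (h.le_right c hc).lt_or_eq with h3 | h3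
    · exact hr.down _ h1 h2 h3
    · exact (haw.trans_lt h1).trans_eq h3.symm
  have hinj : ∀ x y, u x = u y → x = y := fun x y h => u.injective h
  refine ⟨(kBruhatCover_iff hfin).mpr ⟨a, b, hak, hkb, rfl, hu, ?_⟩, ?_, ?_, ?_⟩
  · intro c h1 h2 h3 h4
    rcases le_or_gt (c : ℕ) k with hc | hc
    · exact absurd (h.inversion a c h1 h3 (hleft c hc h3 h4)).2 (not_lt.mpr hc)
    · exact absurd (h.inversion c b h2 h4 (hright c hc h3 h4)).1 (not_le.mpr hc)
  · intro x hx
    rw [mul_swap_apply]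
    split_ifs with e e'
    · subst e; exact hbw
    · subst e'; omega
    · exact h.le_left x hx
  · intro x hx
    rw [mul_swap_apply]
    split_ifs with e e'
    · subst e; omega
    · subst e'; exact haw
    · exact h.le_right x hx
  · intro x y hxy h1 h2
    have hxy' : (x : ℕ) < y := hxy
    have hi := h.inversion x y hxy
    rw [mul_swap_apply, mul_swap_apply] at h1
    simp only [Equiv.Perm.mul_apply] at h2 hi
    have e1 := hinj x a
    have e2 := hinj x b
    have e3 := hinj y a
    have e4 := hinj y b
    have hlx := hleft x
    have hrx := hright x
    have hly := hleft y
    have hry := hright y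
    have l1 : ∀ s t : ℕ+, s < t ↔ (s : ℕ) < t := fun s t => Iff.rfl
    have l2 : ∀ s t : ℕ+, s = t ↔ (s : ℕ) = t := fun s t => PNat.coe_inj.symm
    clear hleft hright hinj hr h
    split_ifs at h1 <;> subst_vars <;> simp only [l1, l2] at * <;> omega

theorem exists_removable {ξ : Equiv.Perm ℕ+} (hfin : finSupp ξ) (hne : ξ ≠ 1) :
    ∃ α β, Removable ξ α β := by
  have hup : {x | x < ξ x}.Nonempty := by
    by_contra hcon
    rw [Set.not_nonempty_iff_eq_empty] at hcon
    have hle : ∀ x, ξ x ≤ x := fun x => by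
      by_contra h
      exact (Set.eq_empty_iff_forall_notMem.mp hcon x) (not_le.mp h)
    refine hne (Equiv.ext fun x => ?_)
    induction x using PNat.strongInductionOn with
    | _ x ih =>
      rcases (hle x).lt_or_eq with h | h
      · exact absurd (ξ.injective (ih _ h)) h.ne
      · exact h
  have hupfin : {x | x < ξ x}.Finite := hfin.subset fun x hx => ne_of_gt hx
  obtain ⟨α, hα, hmax⟩ := Set.exists_max_image _ id hupfin hup
  have hdown : ∀ x, α < x → ξ x ≤ x := fun x hx => by
    by_contra h
    exact absurd (hmax x (not_le.mp h)) (not_le.mpr hx)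
  have hex : {x | (α < x ∧ x ≤ ξ α) ∧ ξ x ≤ α}.Nonempty := by
    by_contra hcon
    rw [Set.not_nonempty_iff_eq_empty, Set.eq_empty_iff_forall_notMem] at hcon
    have hmaps : Set.MapsTo ξ (Finset.Ioc α (ξ α)) (Finset.Ioc α (ξ α)) := by
      intro x hx
      rw [Finset.coe_Ioc, Set.mem_Ioc] at hx ⊢
      exact ⟨not_le.mp fun h => hcon x ⟨hx, h⟩, (hdown x hx.1).trans hx.2⟩
    have hsurj := Finset.surjOn_of_injOn_of_card_le ξ hmaps ξ.injective.injOn le_rfl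
    obtain ⟨y, hy, hyα⟩ := hsurj (a := ξ α) (by
      rw [Finset.coe_Ioc, Set.mem_Ioc]; exact ⟨hα, le_rfl⟩)
    rw [ξ.injective hyα, Finset.coe_Ioc, Set.mem_Ioc] at hy
    exact lt_irrefl _ hy.1
  have hexfin : {x | (α < x ∧ x ≤ ξ α) ∧ ξ x ≤ α}.Finite :=
    (Set.finite_Ioc α (ξ α)).subset fun x hx => hx.1
  obtain ⟨β, ⟨⟨h1, h2⟩, h3⟩, hmin⟩ := Set.exists_min_image _ ξ hexfin hex
  refine ⟨α, β, h1, h2, h3, fun γ g1 _ g3 => absurd (hdown γ g1) (not_le.mpr g3),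
    fun γ g1 g2 _ => ?_⟩
  rcases le_or_gt (ξ γ) α with h | h
  · exact lt_of_le_of_ne (hmin γ ⟨⟨g1, g2.le.trans h2⟩, h⟩) fun e => g2.ne' (ξ.injective e)
  · exact h3.trans_lt h

theorem excess_finite {ξ : Equiv.Perm ℕ+} (hfin : finSupp ξ) :
    {p : ℕ+ × ℕ+ | ξ⁻¹ p.1 ≤ p.2 ∧ p.2 < p.1}.Finite := by
  obtain ⟨N, hN⟩ := exists_bound hfin.inv
  refine ((Set.finite_Iic N).prod (Set.finite_Iic N)).subset ?_
  rintro ⟨x, y⟩ ⟨h1, h2⟩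
  have hx : x ≤ N := by
    by_contra h
    rw [hN x (not_le.mp h)] at h1
    exact absurd h2 (not_lt.mpr h1)
  exact ⟨hx, (le_of_lt h2).trans hx⟩

theorem Removable.excess_lt {ξ : Equiv.Perm ℕ+} (hfin : finSupp ξ) {α β : ℕ+}
    (hr : Removable ξ α β) :
    {p : ℕ+ × ℕ+ | (ξ * Equiv.swap α β)⁻¹ p.1 ≤ p.2 ∧ p.2 < p.1}.ncard <
      {p : ℕ+ × ℕ+ | ξ⁻¹ p.1 ≤ p.2 ∧ p.2 < p.1}.ncard := by
  have hlt := hr.lt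
  have hle := hr.le_apply
  have hle' := hr.apply_le
  have hinv : ∀ x, ξ⁻¹ (ξ x) = x := fun x => by simp
  refine Set.ncard_lt_ncard (ssubset_of_subset_of_ne ?_ ?_) (excess_finite hfin)
  · rintro ⟨x, y⟩ ⟨h1, h2⟩
    obtain ⟨x, rfl⟩ := ξ.surjective x
    simp only [mul_inv_rev, Equiv.swap_inv, Equiv.Perm.mul_apply, hinv,
      Equiv.swap_apply_def] at h1
    refine ⟨?_, h2⟩
    simp only [hinv]
    split_ifs at h1 with e e'
    · subst e; exact hlt.le.trans h1
    · subst e'; exact absurd (h1.trans_lt h2) (not_lt.mpr hle')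
    · exact h1
  · intro heq
    have hmem : (ξ α, α) ∈ {p : ℕ+ × ℕ+ | ξ⁻¹ p.1 ≤ p.2 ∧ p.2 < p.1} :=
      ⟨by simp, hlt.trans_le hle⟩
    rw [← heq] at hmem
    have := hmem.1
    simp only [mul_inv_rev, Equiv.swap_inv, Equiv.Perm.mul_apply, hinv,
      Equiv.swap_apply_left] at this
    exact absurd hlt (not_lt.mpr this)

theorem Compat.kBruhatLE_mul {k : ℕ} {u ξ : Equiv.Perm ℕ+} (hu : finSupp u) (hξ : finSupp ξ)
    (h : Compat k u (ξ * u)) : kBruhatLE k u (ξ * u) := by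
  induction hn : {p : ℕ+ × ℕ+ | ξ⁻¹ p.1 ≤ p.2 ∧ p.2 < p.1}.ncard
    using Nat.strong_induction_on generalizing u ξ with
  | _ n ih =>
  by_cases hne : ξ = 1
  · rw [hne, one_mul]
    exact Relation.ReflTransGen.refl
  · obtain ⟨α, β, hr⟩ := exists_removable hξ hne
    obtain ⟨hcov, hcompat⟩ := hr.cover hu h
    have heq : ξ * u = ξ * Equiv.swap α β * (Equiv.swap α β * u) := by
      rw [mul_assoc, ← mul_assoc (Equiv.swap α β), Equiv.swap_mul_self, one_mul]
    rw [heq] at hcompat ⊢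
    exact Relation.ReflTransGen.head hcov
      (ih _ (hn ▸ hr.excess_lt hξ) ((finSupp_swap α β).mul hu) (hξ.mul (finSupp_swap α β))
        hcompat rfl)

/-- Intervals `[u, w]_k` depend only on `w * u⁻¹`. -/
theorem kBruhatLE_transfer {k l : ℕ} {u v w x : Equiv.Perm ℕ+} (hu : finSupp u) (hx : finSupp x)
    (huv : kBruhatLE k u v) (hvw : kBruhatLE k v w) (h : Compat l x (w * u⁻¹ * x)) :
    kBruhatLE l x (v * u⁻¹ * x) ∧ Compat l (v * u⁻¹ * x) (w * u⁻¹ * x) := by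
  induction huv using Relation.ReflTransGen.head_induction_on generalizing x with
  | refl =>
    rw [mul_inv_cancel, one_mul]
    exact ⟨Relation.ReflTransGen.refl, h⟩
  | @head u u' hcov hle ih =>
    have hu' := hcov.finSupp_right hu
    have hcompat : Compat k u' (w * u⁻¹ * u) := by
      rw [inv_mul_cancel_right]
      exact kBruhatLE.compat hu' (hle.trans hvw)
    obtain ⟨α, β, rfl, hr⟩ := removable_of_cover hu hcov hcompat
    obtain ⟨hcov', hcompat'⟩ := hr.cover hx h
    have heq : ∀ t : Equiv.Perm ℕ+,
        t * (Equiv.swap α β * u)⁻¹ * (Equiv.swap α β * x) = t * u⁻¹ * x := by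
      intro t
      rw [mul_inv_rev, Equiv.swap_inv]
      simp only [mul_assoc, Equiv.swap_mul_self_mul]
    have := ih hu' ((finSupp_swap α β).mul hx) (by rwa [heq])
    rw [heq, heq] at this
    exact ⟨this.1.head hcov', this.2⟩

theorem exists_compat {ζ : Equiv.Perm ℕ+} (hζ : finSupp ζ) :
    ∃ k : ℕ, 0 < k ∧ ∃ u : Equiv.Perm ℕ+, finSupp u ∧ Compat k u (ζ * u) := by
  obtain ⟨N, hN⟩ := exists_bound hζ
  let e : Fin N ≃ {x : ℕ+ // x ≤ N} :=
    { toFun := fun i => ⟨⟨i + 1, Nat.succ_pos _⟩, i.2⟩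
      invFun := fun x => ⟨(x : ℕ+) - 1, by
        have h1 : ((x : ℕ+) : ℕ) ≤ N := x.2
        have h2 := (x : ℕ+).pos
        omega⟩
      left_inv := fun i => by simp
      right_inv := fun x => by
        refine Subtype.ext (PNat.eq ?_)
        change ((x : ℕ+) : ℕ) - 1 + 1 = (x : ℕ+)
        exact Nat.sub_add_cancel (x : ℕ+).pos }
  let K : ℕ+ → ℤ := fun x => if x ≤ ζ x then -(x : ℕ) else 3 * (N : ℕ) - (x : ℕ)
  let f : Fin N → ℤ := fun i => K (e i)
  let u : Equiv.Perm ℕ+ := (Tuple.sort f).extendDomain e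
  have hue : ∀ i, u (e i) = e (Tuple.sort f i) := fun i =>
    Equiv.Perm.extendDomain_apply_image _ _ _
  have huN : ∀ x, N < x → u x = x := fun x hx =>
    Equiv.Perm.extendDomain_apply_not_subtype _ _ (not_le.mpr hx)
  have hmono : ∀ a b, a ≤ b → b ≤ N → K (u a) ≤ K (u b) := by
    intro a b hab hb
    obtain ⟨i, hi⟩ := e.surjective ⟨a, hab.trans hb⟩
    obtain ⟨j, hj⟩ := e.surjective ⟨b, hb⟩
    have hi' : ((e i : {x : ℕ+ // x ≤ N}) : ℕ+) = a := by rw [hi]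
    have hj' : ((e j : {x : ℕ+ // x ≤ N}) : ℕ+) = b := by rw [hj]
    subst hi' hj'
    rw [hue, hue]
    refine Tuple.monotone_sort f (?_ : i ≤ j)
    have : (i : ℕ) + 1 ≤ j + 1 := hab
    exact Fin.mk_le_of_le_val (by omega)
  have hleft : ∀ a b, a ≤ b → b ≤ N → u b ≤ ζ (u b) → u a ≤ ζ (u a) := by
    intro a b hab hb h
    by_contra hcon
    have h1 := hmono a b hab hb
    have h2 : (u a : ℕ) ≤ N := (apply_le_iff huN a).mpr (hab.trans hb)
    have h3 := N.pos
    simp only [K, if_pos h, if_neg hcon] at h1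
    omega
  have hufin : finSupp u := (Set.finite_Iic N).subset fun x hx => by
    by_contra h
    exact hx (huN x (not_le.mp h))
  obtain ⟨k, ⟨hkN, hk⟩, hkmax⟩ := Set.exists_max_image {a | a ≤ N ∧ u a ≤ ζ (u a)} id
    ((Set.finite_Iic N).subset fun a ha => ha.1)
    ⟨u⁻¹ 1, by
      refine ⟨?_, by simp⟩
      rw [← apply_le_iff huN]
      simp⟩
  have hL : ∀ a, a ≤ k → u a ≤ ζ (u a) := fun a ha => hleft a k ha hkN hk
  have hR : ∀ a, a ≤ N → k < a → ζ (u a) < u a := fun a ha hka => by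
    by_contra h
    exact absurd (hkmax a ⟨ha, not_lt.mp h⟩) (not_le.mpr hka)
  refine ⟨k, k.pos, u, hufin, hL, fun a ha => ?_, fun a b hab h1 h2 => ?_⟩
  · rcases le_or_gt a N with h | h
    · exact (hR a h ha).le
    · rw [Equiv.Perm.mul_apply, huN a h, hN a h]
  · simp only [Equiv.Perm.mul_apply] at h2
    have hb : b ≤ N := by
      by_contra h
      rw [not_le] at h
      rw [huN b h] at h1 h2
      rw [hN b h] at h2
      have h3 : N < u a := by
        by_contra h4
        exact absurd ((apply_le_iff hN _).mpr (not_lt.mp h4)) (not_le.mpr (h.trans h2))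
      rw [hN _ h3] at h2
      exact h1.asymm h2
    have h3 := hmono a b hab.le hb
    have h1' : (u a : ℕ) < u b := h1
    rcases le_or_gt b k with hbk | hbk
    · simp only [K, if_pos (hL a (hab.le.trans hbk)), if_pos (hL b hbk)] at h3
      omega
    · rcases le_or_gt a k with hak | hak
      · exact ⟨hak, hbk⟩
      · simp only [K, if_neg (not_le.mpr (hR a (hab.le.trans hb) hak)),
          if_neg (not_le.mpr (hR b hb hbk))] at h3
        omega

theorem kBruhatLE.finSupp_right {k : ℕ} {u w : Equiv.Perm ℕ+} (h : kBruhatLE k u w) (hu : finSupp u) :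
    finSupp w := by
  induction h with
  | refl => exact hu
  | tail _ hcov ih => exact hcov.finSupp_right ih

theorem kBruhatLE.len_le {k : ℕ} {u w : Equiv.Perm ℕ+} (h : kBruhatLE k u w) :
    len u ≤ len w ∧ (len u = len w → u = w) := by
  induction h with
  | refl => exact ⟨le_rfl, fun _ => rfl⟩
  | tail _ hcov ih =>
    obtain ⟨a, b, -, -, -, hlen⟩ := hcov
    exact ⟨by omega, fun h => by omega⟩

theorem kBruhatLE.exists_chain {k : ℕ} {v w : Equiv.Perm ℕ+} (h : kBruhatLE k v w) :
    ∃ (m : ℕ) (c : ℕ → Equiv.Perm ℕ+), c 0 = v ∧ c m = w ∧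
      ∀ i, i < m → kBruhatCover k (c i) (c (i + 1)) := by
  induction h using Relation.ReflTransGen.head_induction_on with
  | refl => exact ⟨0, fun _ => w, rfl, rfl, fun i hi => absurd hi (Nat.not_lt_zero i)⟩
  | @head u u' hcov _ ih =>
    obtain ⟨m, c, h0, hm, hc⟩ := ih
    refine ⟨m + 1, fun i => Nat.casesOn i u c, rfl, hm, fun i hi => ?_⟩
    cases i with
    | zero =>
      change kBruhatCover k u (c 0)
      rwa [h0]
    | succ i => exact hc i (Nat.lt_of_succ_lt_succ hi)

theorem kBruhatLE.zlen_eq {k : ℕ} {u v : Equiv.Perm ℕ+} (hu : finSupp u) (h : kBruhatLE k u v) :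
    zlen (v * u⁻¹) = len v - len u := by
  have hc : Compat k u (v * u⁻¹ * u) := by
    rw [inv_mul_cancel_right]
    exact h.compat hu
  have := hc.len_mul hu ((h.finSupp_right hu).mul hu.inv)
  rw [inv_mul_cancel_right] at this
  omega

theorem preceq.zlen_le {η ζ : Equiv.Perm ℕ+} (h : preceq η ζ) :
    zlen η ≤ zlen ζ ∧ (zlen η = zlen ζ → η = ζ) := by
  obtain ⟨k, -, u, hu, h1, h2⟩ := h
  have e1 := kBruhatLE.zlen_eq hu h1
  have e2 := kBruhatLE.zlen_eq hu (h1.trans h2)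
  rw [mul_inv_cancel_right] at e1 e2
  obtain ⟨hle, heq⟩ := h2.len_le
  refine ⟨by omega, fun h => ?_⟩
  exact mul_right_cancel (heq (by omega))

theorem one_preceq {ζ : Equiv.Perm ℕ+} (hζ : finSupp ζ) : preceq 1 ζ := by
  obtain ⟨k, hk, u, hu, h⟩ := exists_compat hζ
  rw [← one_mul u] at h
  refine ⟨k, hk, u, hu, ?_, ?_⟩
  · rw [one_mul]
    exact Relation.ReflTransGen.refl
  · rw [one_mul] at h ⊢
    exact h.kBruhatLE_mul hu hζ

theorem preceq_refl {ζ : Equiv.Perm ℕ+} (hζ : finSupp ζ) : preceq ζ ζ := by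
  obtain ⟨k, hk, u, hu, h⟩ := exists_compat hζ
  exact ⟨k, hk, u, hu, h.kBruhatLE_mul hu hζ, Relation.ReflTransGen.refl⟩

theorem preceq.trans {η ξ ζ : Equiv.Perm ℕ+} (hη : finSupp η) (hξ : finSupp ξ)
    (h : preceq η ξ) (h' : preceq ξ ζ) : preceq η ζ := by
  obtain ⟨k, -, u, hu, h1, h2⟩ := h
  obtain ⟨l, hl, x, hx, h3, h4⟩ := h'
  have ht := kBruhatLE_transfer (l := l) hu hx h1 h2 (by
    rw [mul_inv_cancel_right]
    exact h3.compat hx)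
  simp only [mul_inv_cancel_right] at ht
  refine ⟨l, hl, x, hx, ht.1, Relation.ReflTransGen.trans ?_ h4⟩
  have heq : ξ * x = ξ * η⁻¹ * (η * x) := by
    rw [mul_assoc, inv_mul_cancel_left]
  rw [heq] at ht ⊢
  exact ht.2.kBruhatLE_mul (hη.mul hx) (hξ.mul hη.inv)

theorem preceq.exists_chain {η ζ : Equiv.Perm ℕ+} (h : preceq η ζ) :
    ∃ (m : ℕ) (c : ℕ → Equiv.Perm ℕ+), c 0 = η ∧ c m = ζ ∧
      (m : ℤ) = zlen ζ - zlen η ∧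
      ∀ i, i < m → preceq (c i) (c (i + 1)) ∧ c i ≠ c (i + 1) ∧
        zlen (c (i + 1)) = zlen (c i) + 1 := by
  obtain ⟨k, hk, u, hu, h1, h2⟩ := h
  obtain ⟨m, c, h0, hm, hc⟩ := h2.exists_chain
  have hle : ∀ i, i ≤ m → kBruhatLE k u (c i) := by
    intro i
    induction i with
    | zero => exact fun _ => h0 ▸ h1
    | succ i ih => exact fun hi => (ih (by omega)).tail (hc i hi)
  have hz : ∀ i, i ≤ m → zlen (c i * u⁻¹) = len (c i) - len u := fun i hi =>
    kBruhatLE.zlen_eq hu (hle i hi)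
  have hstep : ∀ i, i < m → zlen (c (i + 1) * u⁻¹) = zlen (c i * u⁻¹) + 1 := by
    intro i hi
    obtain ⟨a, b, -, -, -, hlen⟩ := hc i hi
    rw [hz i hi.le, hz (i + 1) hi]
    omega
  have htot : ∀ i, i ≤ m → (i : ℤ) = zlen (c i * u⁻¹) - zlen (c 0 * u⁻¹) := by
    intro i
    induction i with
    | zero => simp
    | succ i ih =>
      intro hi
      have := ih (by omega)
      have := hstep i hi
      push_cast
      omega
  have h0' : c 0 * u⁻¹ = η := by rw [h0, mul_inv_cancel_right]
  have hm' : c m * u⁻¹ = ζ := by rw [hm, mul_inv_cancel_right]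
  refine ⟨m, fun i => c i * u⁻¹, h0', hm', ?_, fun i hi => ⟨⟨k, hk, u, hu, ?_, ?_⟩, ?_, hstep i hi⟩⟩
  · rw [htot m le_rfl, hm', h0']
  · rw [inv_mul_cancel_right]
    exact hle i hi.le
  · rw [inv_mul_cancel_right, inv_mul_cancel_right]
    exact Relation.ReflTransGen.single (hc i hi)
  · intro heq
    have := hstep i hi
    simp only at heq
    rw [heq] at this
    omega

/-- Theorem 3.2.3(i): `≼` is a partial order on `S_∞` with minimum element `e`,
graded by the rank function `ζ ↦ |ζ|`. -/
theorem stmt7 :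
    (∀ ζ : Equiv.Perm ℕ+, finSupp ζ → preceq ζ ζ) ∧
    (∀ η ζ : Equiv.Perm ℕ+, finSupp η → finSupp ζ → preceq η ζ → preceq ζ η → η = ζ) ∧
    (∀ η ξ ζ : Equiv.Perm ℕ+, finSupp η → finSupp ξ → finSupp ζ →
      preceq η ξ → preceq ξ ζ → preceq η ζ) ∧
    (∀ ζ : Equiv.Perm ℕ+, finSupp ζ → preceq 1 ζ) ∧
    zlen 1 = 0 ∧
    (∀ η ζ : Equiv.Perm ℕ+, finSupp η → finSupp ζ → preceq η ζ →
      ∃ (m : ℕ) (c : ℕ → Equiv.Perm ℕ+), c 0 = η ∧ c m = ζ ∧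
        (m : ℤ) = zlen ζ - zlen η ∧
        ∀ i, i < m → preceq (c i) (c (i + 1)) ∧ c i ≠ c (i + 1) ∧
          zlen (c (i + 1)) = zlen (c i) + 1) := by
  refine ⟨fun _ => preceq_refl, fun η ζ _ _ h h' => ?_,
    fun η ξ ζ hη hξ _ h h' => h.trans hη hξ h', fun _ => one_preceq, ?_,
    fun η ζ _ _ h => h.exists_chain⟩
  · exact h.zlen_le.2 (le_antisymm h.zlen_le.1 h'.zlen_le.1)
  · simp [zlen]
end
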